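/- arXiv:1912.08906 — 2 statements merged into one kernel-verified Lean document; each statement's English description precedes it below -/
import Mathlib

section
/- Let p be an odd prime and let G be a quasi-powerful p-group. Then for every integer i ≥ 1 the subgroup G^{p^i} is a powerful p-group; that is, the commutator subgroup [G^{p^i}, G^{p^i}] is contained in the subgroup generated by the p-th powers of elements of G^{p^i}. -/
/-- The subgroup of `G` generated by all `n`-th powers. -/
def powSubgroup (G : Type*) [Group G] (n : ℕ) : Subgroup G :=
  Subgroup.closure {x : G | ∃ g : G, g ^ n = x}

/-- `Ω_k`-type subgroup: generated by all elements whose `n`-th power is trivial. -/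
def omegaSubgroup (G : Type*) [Group G] (n : ℕ) : Subgroup G :=
  Subgroup.closure {g : G | g ^ n = 1}

/-- A group is powerful (for a prime `p`) if `[G,G] ≤ G^p`. -/
def IsPowerful (p : ℕ) (G : Type*) [Group G] : Prop :=
  commutator G ≤ powSubgroup G p

/-- A group is quasi-powerful (for a prime `p`) if `G/Z(G)` is powerful. -/
def IsQuasiPowerful (p : ℕ) (G : Type*) [Group G] : Prop :=
  IsPowerful p (G ⧸ Subgroup.center G)

/-- The commutator `[x,y] = x⁻¹y⁻¹xy`. -/
def pcomm {G : Type*} [Group G] (a b : G) : G := a⁻¹ * b⁻¹ * a * b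

/-- The subgroup generated by the `n`-th powers of the elements of the subgroup `N`. -/
def Subgroup.powClosure {G : Type*} [Group G] (N : Subgroup G) (n : ℕ) : Subgroup G :=
  Subgroup.closure {x : G | ∃ g ∈ N, g ^ n = x}

namespace Subgroup

open scoped commutatorElement

variable {G H : Type*} [Group G] [Group H]

lemma pow_mem_powClosure {N : Subgroup G} {g : G} (hg : g ∈ N) (n : ℕ) :
    g ^ n ∈ N.powClosure n :=
  subset_closure ⟨g, hg, rfl⟩

lemma powClosure_le {N K : Subgroup G} {n : ℕ} :
    N.powClosure n ≤ K ↔ ∀ g ∈ N, g ^ n ∈ K := by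
  refine ⟨fun h g hg => h (pow_mem_powClosure hg n), fun h => (closure_le K).2 ?_⟩
  rintro _ ⟨g, hg, rfl⟩
  exact h g hg

lemma map_powClosure (f : G →* H) (N : Subgroup G) (n : ℕ) :
    (N.powClosure n).map f = (N.map f).powClosure n := by
  apply le_antisymm
  · rw [map_le_iff_le_comap, powClosure_le]
    intro g hg
    rw [mem_comap, map_pow]
    exact pow_mem_powClosure (mem_map_of_mem f hg) n
  · rw [powClosure_le]
    rintro _ ⟨g, hg, rfl⟩
    rw [← map_pow]
    exact mem_map_of_mem f (pow_mem_powClosure hg n)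

instance powClosure_normal (N : Subgroup G) [N.Normal] (n : ℕ) : (N.powClosure n).Normal := by
  rw [normal_iff_map_conj_eq]
  intro g
  rw [map_powClosure, normal_iff_map_conj_eq.1 ‹_› g]

/-- In a nilpotent group, a subgroup contained in `K ⊔ ⁅N, ⊤⁆` is contained in `K`. -/
lemma le_of_le_sup_commutator_top [Group.IsNilpotent G] {N K : Subgroup G} [K.Normal]
    (h : N ≤ K ⊔ ⁅N, ⊤⁆) : N ≤ K := by
  have key : ∀ n, N ≤ K ⊔ (⊤ : Subgroup G).lowerCentralSeries n := by
    intro n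
    induction n with
    | zero => simp
    | succ n ih =>
      refine h.trans (sup_le le_sup_left ?_)
      rw [commutator_le]
      intro x hx g _
      obtain ⟨k, hk, l, hl, rfl⟩ := mem_sup_of_normal_left.1 (ih hx)
      have e : ⁅k * l, g⁆ = (k * ⁅l, g⁆ * k⁻¹) * ⁅k, g⁆ := by
        simp only [commutatorElement_def]; group
      rw [e]
      refine mul_mem ?_ ?_
      · refine Normal.conj_mem inferInstance _ (mem_sup_right ?_) k
        exact commutator_mem_commutator hl (mem_top g)
      · exact mem_sup_left (commutator_le_left K ⊤ (commutator_mem_commutator hk (mem_top g)))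
  obtain ⟨n, hn⟩ := nilpotent_iff_lowerCentralSeries.1 ‹Group.IsNilpotent G›
  simpa [hn] using key n

/-- Elements of `N` are central modulo a normal subgroup containing `⁅N, ⊤⁆`. -/
lemma commute_mk_of_commutator_top_le {N K : Subgroup G} [K.Normal] (h : ⁅N, ⊤⁆ ≤ K) {x : G}
    (hx : x ∈ N) (g : G) : Commute (x : G ⧸ K) (g : G ⧸ K) := by
  rw [← commutatorElement_eq_one_iff_commute]
  exact (QuotientGroup.eq_one_iff ⁅x, g⁆).2 (h (commutator_mem_commutator hx (mem_top g)))

end Subgroup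

lemma mul_pow_of_commutator_commute {G : Type*} [Group G] {x y z : G} (h : y * x = x * y * z)
    (hx : Commute z x) (hy : Commute z y) (n : ℕ) :
    (x * y) ^ n = x ^ n * y ^ n * z ^ (n.choose 2) := by
  have hyx : ∀ n : ℕ, y ^ n * x = x * y ^ n * z ^ n := by
    intro n
    induction n with
    | zero => simp
    | succ n ih =>
      calc y ^ (n + 1) * x = y ^ n * (y * x) := by rw [pow_succ, mul_assoc]
        _ = (y ^ n * x) * (y * z) := by rw [h]; simp only [mul_assoc]
        _ = x * y ^ n * (z ^ n * y) * z := by rw [ih]; simp only [mul_assoc]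
        _ = x * y ^ (n + 1) * z ^ (n + 1) := by
          rw [(hy.pow_left n).eq, pow_succ y, pow_succ z]; simp only [mul_assoc]
  induction n with
  | zero => simp
  | succ n ih =>
    calc (x * y) ^ (n + 1) = x ^ n * y ^ n * (z ^ n.choose 2 * (x * y)) := by
          rw [pow_succ, ih]; simp only [mul_assoc]
      _ = x ^ n * (y ^ n * x) * y * z ^ n.choose 2 := by
          rw [((hx.mul_right hy).pow_left _).eq]; simp only [mul_assoc]
      _ = x ^ (n + 1) * y ^ n * (z ^ n * y) * z ^ n.choose 2 := by
          rw [hyx, pow_succ x]; simp only [mul_assoc]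
      _ = x ^ (n + 1) * y ^ (n + 1) * z ^ (n + 1).choose 2 := by
          rw [(hy.pow_left n).eq, Nat.choose_succ_succ' n 1, Nat.choose_one_right,
            pow_add z, pow_succ y]
          simp only [mul_assoc]

lemma mul_pow_prime_of_commutator_commute {G : Type*} [Group G] {p : ℕ} (hodd : Odd p)
    {x y z : G} (h : y * x = x * y * z) (hx : Commute z x) (hy : Commute z y) (hz : z ^ p = 1) :
    (x * y) ^ p = x ^ p * y ^ p := by
  obtain ⟨k, rfl⟩ := hodd
  have hc : (2 * k + 1).choose 2 = (2 * k + 1) * k := by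
    rw [Nat.choose_two_right, Nat.add_sub_cancel, mul_left_comm]
    exact Nat.mul_div_cancel_left _ two_pos
  rw [mul_pow_of_commutator_commute h hx hy, hc, pow_mul, hz, one_pow, mul_one]

lemma pow_mul_of_mul_eq {G : Type*} [Group G] {a m z : G} (h : a * m = m * a * z)
    (ha : Commute z a) (n : ℕ) : a ^ n * m = m * a ^ n * z ^ n := by
  induction n with
  | zero => simp
  | succ n ih =>
    calc a ^ (n + 1) * m = a ^ n * m * (a * z) := by
          rw [pow_succ, mul_assoc, h]; simp only [mul_assoc]
      _ = m * a ^ n * (z ^ n * a) * z := by rw [ih]; simp only [mul_assoc]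
      _ = m * a ^ (n + 1) * z ^ (n + 1) := by
          rw [(ha.pow_left n).eq, pow_succ a, pow_succ z]; simp only [mul_assoc]

namespace Subgroup

open scoped commutatorElement

variable {G : Type*} [Group G] {p : ℕ}

/-- If `N` is powerfully embedded, then so is `N ^ p`. -/
lemma commutator_powClosure_le [Group.IsNilpotent G] (hodd : Odd p) {N : Subgroup G} [N.Normal]
    (hN : ⁅N, ⊤⁆ ≤ N.powClosure p) :
    ⁅N.powClosure p, (⊤ : Subgroup G)⁆ ≤ (N.powClosure p).powClosure p := by
  set P := N.powClosure p
  apply le_of_le_sup_commutator_top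
  set K := P.powClosure p ⊔ ⁅⁅P, (⊤ : Subgroup G)⁆, (⊤ : Subgroup G)⁆
  have hpow : ∀ x ∈ P, (x : G ⧸ K) ^ p = 1 := fun x hx =>
    (QuotientGroup.eq_one_iff (x ^ p)).2 (mem_sup_left (pow_mem_powClosure hx p))
  suffices h : P ≤ (center (G ⧸ K)).comap (QuotientGroup.mk' K) by
    rw [commutator_le]
    intro x hx g _
    rw [← QuotientGroup.eq_one_iff]
    exact commutatorElement_eq_one_iff_mul_comm.2 (mem_center_iff.1 (h hx) (g : G ⧸ K)).symm
  refine powClosure_le.2 fun n hn => ?_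
  rw [mem_comap, mem_center_iff]
  intro q
  obtain ⟨h, rfl⟩ := QuotientGroup.mk_surjective q
  set c := ⁅n⁻¹, h⁆ with hc
  have hcP : c ∈ P := hN (commutator_mem_commutator (inv_mem hn) (mem_top h))
  set z := ⁅c⁻¹, n⁻¹⁆ with hz
  have hzc : z ∈ ⁅P, (⊤ : Subgroup G)⁆ :=
    commutator_mem_commutator (inv_mem hcP) (mem_top _)
  have hzP : z ∈ P := commutator_le_left P ⊤ hzc
  have hcomm := commute_mk_of_commutator_top_le (K := K) le_sup_right hzc
  have e : c * n = n * c * z := by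
    simp only [hz, commutatorElement_def]; group
  have e' : n * c = h * n * h⁻¹ := by
    simp only [hc, commutatorElement_def]; group
  have key := mul_pow_prime_of_commutator_commute hodd
    (x := (n : G ⧸ K)) (y := (c : G ⧸ K)) (z := (z : G ⧸ K))
    (congrArg (QuotientGroup.mk (s := K)) e) (hcomm n) (hcomm c) (hpow z hzP)
  rw [hpow c hcP, mul_one, ← QuotientGroup.mk_mul, e'] at key
  simp only [QuotientGroup.mk_mul, QuotientGroup.mk_inv, conj_pow] at key
  simpa [mul_inv_eq_iff_eq_mul] using key

/-- If the powerfully embedded subgroup `N` is generated by `S`, then `N ^ p` is contained in every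
normal subgroup containing the `p`-th powers of the elements of `S`. -/
lemma powClosure_closure_le [Group.IsNilpotent G] (hodd : Odd p) {S : Set G}
    (hN : ⁅closure S, ⊤⁆ ≤ (closure S).powClosure p) [(closure S).Normal]
    {L : Subgroup G} [L.Normal] (hS : ∀ s ∈ S, s ^ p ∈ L) : (closure S).powClosure p ≤ L := by
  apply le_of_le_sup_commutator_top
  set P := (closure S).powClosure p
  set K := L ⊔ ⁅P, (⊤ : Subgroup G)⁆
  rw [powClosure_le]
  intro g hg
  rw [← QuotientGroup.eq_one_iff]
  induction hg using closure_induction with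
  | mem x hx => exact (QuotientGroup.eq_one_iff (x ^ p)).2 (mem_sup_left (hS x hx))
  | one => simp
  | inv x _ hx => simpa using hx
  | mul x y hx hy hxp hyp =>
    set z := ⁅y⁻¹, x⁻¹⁆ with hz
    have hzP : z ∈ P := hN (commutator_mem_commutator (inv_mem hy) (mem_top _))
    have hcomm := commute_mk_of_commutator_top_le (N := P) (K := K) le_sup_right hzP
    have e : y * x = x * y * z := by
      simp only [hz, commutatorElement_def]; group
    have e' := congrArg (QuotientGroup.mk (s := K)) e
    simp only [QuotientGroup.mk_mul, QuotientGroup.mk_pow] at e' hxp hyp ⊢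
    have hzp : (z : G ⧸ K) ^ p = 1 := by
      have := pow_mul_of_mul_eq e' (hcomm y) p
      rw [hyp] at this
      simpa using this
    rw [mul_pow_prime_of_commutator_commute hodd e' (hcomm x) (hcomm y) hzp, hxp, hyp, mul_one]

end Subgroup

section Powerful

open Subgroup

variable {G H : Type*} [Group G] [Group H]

lemma map_powSubgroup_of_surjective {f : G →* H} (hf : Function.Surjective f) (n : ℕ) :
    (powSubgroup G n).map f = powSubgroup H n := by
  rw [powSubgroup, powSubgroup, MonoidHom.map_closure]
  congr 1
  ext x
  constructor
  · rintro ⟨_, ⟨g, rfl⟩, rfl⟩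
    exact ⟨f g, (map_pow f g n).symm⟩
  · rintro ⟨h, rfl⟩
    obtain ⟨g, rfl⟩ := hf h
    exact ⟨g ^ n, ⟨g, rfl⟩, map_pow f g n⟩

instance powSubgroup_normal (n : ℕ) : (powSubgroup G n).Normal := by
  rw [normal_iff_map_conj_eq]
  intro g
  exact map_powSubgroup_of_surjective (MulAut.conj g).surjective n

lemma powSubgroup_one : powSubgroup G 1 = ⊤ := by
  simp [powSubgroup]

lemma powClosure_top (n : ℕ) : (⊤ : Subgroup G).powClosure n = powSubgroup G n := by
  simp [powClosure, powSubgroup]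

/-- In a powerful `p`-group with `p` odd, the subgroups `G ^ (p ^ i)` are powerfully embedded. -/
lemma IsPowerful.commutator_powSubgroup_le [Group.IsNilpotent G] {p : ℕ} (hodd : Odd p)
    (h : IsPowerful p G) (i : ℕ) :
    ⁅powSubgroup G (p ^ i), (⊤ : Subgroup G)⁆ ≤ (powSubgroup G (p ^ i)).powClosure p := by
  induction i with
  | zero => simpa [powSubgroup_one, powClosure_top, IsPowerful, commutator_def] using h
  | succ i ih =>
    have e : powSubgroup G (p ^ (i + 1)) = (powSubgroup G (p ^ i)).powClosure p := by
      apply le_antisymm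
      · refine (closure_le _).2 ?_
        rintro _ ⟨g, rfl⟩
        rw [pow_succ, pow_mul]
        exact pow_mem_powClosure (N := powSubgroup G (p ^ i))
          (Subgroup.subset_closure ⟨g, rfl⟩) p
      · have : (closure {x : G | ∃ g : G, g ^ (p ^ i) = x}).Normal :=
          powSubgroup_normal (p ^ i)
        refine powClosure_closure_le hodd ih ?_
        rintro _ ⟨g, rfl⟩
        rw [← pow_mul, ← pow_succ]
        exact Subgroup.subset_closure ⟨g, rfl⟩
    rw [e]
    exact commutator_powClosure_le hodd ih

open scoped commutatorElement in
/-- In a quasi-powerful `p`-group with `p` odd, the subgroups `G ^ (p ^ i)`, `1 ≤ i`, are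
powerful. -/
lemma IsQuasiPowerful.commutator_powSubgroup_le [Finite G] {p : ℕ} (hp : p.Prime) (hodd : Odd p)
    (hG : IsPGroup p G) (hQP : IsQuasiPowerful p G) {i : ℕ} (hi : 1 ≤ i) :
    ⁅powSubgroup G (p ^ i), powSubgroup G (p ^ i)⁆ ≤ (powSubgroup G (p ^ i)).powClosure p := by
  have : Fact p.Prime := ⟨hp⟩
  set M := powSubgroup G (p ^ i)
  set K := M.powClosure p
  have hnil : Group.IsNilpotent (G ⧸ center G) :=
    (hG.to_quotient (center G)).isNilpotent
  have hH := IsPowerful.commutator_powSubgroup_le hodd hQP i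
  rw [← map_powSubgroup_of_surjective (QuotientGroup.mk'_surjective (center G)),
    ← map_powClosure] at hH
  have hcentral : ∀ m ∈ M, ∀ a g : G, Commute ((⁅m, a⁆ : G) : G ⧸ K) (g : G ⧸ K) := by
    intro m hm a g
    obtain ⟨k, hk, hkz⟩ := hH (commutator_mem_commutator
      (mem_map_of_mem (QuotientGroup.mk' (center G)) hm)
      (mem_top (QuotientGroup.mk' (center G) a)))
    have hz : k⁻¹ * ⁅m, a⁆ ∈ center G := QuotientGroup.eq.1 hkz
    have hk1 : (k : G ⧸ K) = 1 := (QuotientGroup.eq_one_iff k).2 hk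
    have hc := congrArg (QuotientGroup.mk (s := K)) (mem_center_iff.1 hz g)
    simp only [QuotientGroup.mk_mul, QuotientGroup.mk_inv, hk1, inv_one, one_mul] at hc
    exact hc.symm
  have hpow : ∀ m ∈ M, ∀ a : G, Commute (m : G ⧸ K) ((a : G ⧸ K) ^ p) := by
    intro m hm a
    have hzM : ⁅m⁻¹, a⁻¹⁆ ∈ M := commutator_le_left M ⊤
      (commutator_mem_commutator (inv_mem hm) (mem_top _))
    have hzp : ((⁅m⁻¹, a⁻¹⁆ : G) : G ⧸ K) ^ p = 1 :=
      (QuotientGroup.eq_one_iff (⁅m⁻¹, a⁻¹⁆ ^ p)).2 (pow_mem_powClosure hzM p)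
    have e : m * a = a * m * ⁅m⁻¹, a⁻¹⁆ := by
      simp only [commutatorElement_def]; group
    have e' : a * m = m * a * ⁅m⁻¹, a⁻¹⁆⁻¹ := by
      rw [e, mul_inv_cancel_right]
    have key := pow_mul_of_mul_eq (a := (a : G ⧸ K)) (m := (m : G ⧸ K))
      (z := ((⁅m⁻¹, a⁻¹⁆ : G) : G ⧸ K)⁻¹) (congrArg (QuotientGroup.mk (s := K)) e')
      (hcentral m⁻¹ (inv_mem hm) a⁻¹ a).inv_left p
    rw [inv_pow, hzp, inv_one, mul_one] at key
    exact key.symm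
  have hle : M ≤ (centralizer (QuotientGroup.mk' K '' M)).comap
      (QuotientGroup.mk' K) := by
    refine (closure_le _).2 ?_
    rintro _ ⟨g, rfl⟩
    rw [SetLike.mem_coe, mem_comap, mem_centralizer_iff]
    rintro _ ⟨m, hm, rfl⟩
    have e : g ^ p ^ i = (g ^ p ^ (i - 1)) ^ p := by
      rw [← pow_mul, ← pow_succ, Nat.sub_add_cancel hi]
    rw [e, map_pow]
    exact (hpow m hm (g ^ p ^ (i - 1))).eq
  rw [commutator_le]
  intro x hx y hy
  rw [← QuotientGroup.eq_one_iff]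
  exact commutatorElement_eq_one_iff_mul_comm.2
    (mem_centralizer_iff.1 (hle hy) _ ⟨x, hx, rfl⟩)

end Powerful

theorem powSubgroup_isPowerful (p : ℕ) (hp : p.Prime) (hodd : Odd p)
    (G : Type*) [Group G] [Finite G]
    (hG : IsPGroup p G) (hQP : IsQuasiPowerful p G) (i : ℕ) (hi : 1 ≤ i) :
    ⁅powSubgroup G (p ^ i), powSubgroup G (p ^ i)⁆ ≤
      Subgroup.closure {x : G | ∃ g ∈ powSubgroup G (p ^ i), g ^ p = x} := by
  exact IsQuasiPowerful.commutator_powSubgroup_le hp hodd hG hQP hi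
end

section
/- Let p be an odd prime, let G be a quasi-powerful p-group and let x, y ∈ G. Then the order of the commutator [x,y] divides the order of y (in particular o([x,y]) ≤ o(y)); equivalently, for every nonnegative integer i, if y^{p^i} = 1 then [x,y]^{p^i} = 1. -/
open scoped commutatorElement

section ClassTwo

variable {G : Type*} [Group G]

/-- The power formula in class two, with the commutator `d` defined by `b * a = d * (a * b)`. -/
theorem mul_pow_of_central_commutator {a b d : G} (h : b * a = d * (a * b)) (hda : Commute d a)
    (hdb : Commute d b) (n : ℕ) : (a * b) ^ n = d ^ n.choose 2 * (a ^ n * b ^ n) := by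
  have hmove : ∀ m : ℕ, b ^ m * a = d ^ m * (a * b ^ m) := by
    intro m
    induction m with
    | zero => simp
    | succ m ih =>
      calc b ^ (m + 1) * a = b ^ m * (b * a) := by rw [pow_succ, mul_assoc]
        _ = (b ^ m * d) * (a * b) := by rw [h, mul_assoc]
        _ = d * (b ^ m * a) * b := by rw [(hdb.pow_right m).eq.symm]; simp only [mul_assoc]
        _ = d ^ (m + 1) * (a * b ^ (m + 1)) := by
          rw [ih, pow_succ' d, pow_succ b]; simp only [mul_assoc]
  induction n with
  | zero => simp
  | succ n ih =>
    calc (a * b) ^ (n + 1) = d ^ n.choose 2 * (a ^ n * (b ^ n * a) * b) := by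
          rw [pow_succ, ih]; simp only [mul_assoc]
      _ = d ^ n.choose 2 * ((a ^ n * d ^ n) * (a * b ^ n) * b) := by
          rw [hmove]; simp only [mul_assoc]
      _ = d ^ n.choose 2 * ((d ^ n * a ^ n) * (a * b ^ n) * b) := by
          rw [(hda.pow_pow n n).eq]
      _ = d ^ (n + 1).choose 2 * (a ^ (n + 1) * b ^ (n + 1)) := by
          have : (n + 1).choose 2 = n.choose 2 + n := by
            rw [Nat.choose_succ_succ' n 1, Nat.choose_one_right, add_comm]
          rw [this, pow_add, pow_succ a, pow_succ b]; simp only [mul_assoc]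

theorem mul_pow_prime_of_central_commutator {p : ℕ} (hp : p.Prime) (hodd : Odd p) {a b : G}
    (hda : Commute ⁅b, a⁆ a) (hdb : Commute ⁅b, a⁆ b) (hd : ⁅b, a⁆ ^ p = 1) :
    (a * b) ^ p = a ^ p * b ^ p := by
  have h2 : 2 < p := by
    rcases hodd with ⟨k, hk⟩
    have := hp.two_le
    omega
  obtain ⟨k, hk⟩ := hp.dvd_choose_self (k := 2) (by norm_num) h2
  rw [mul_pow_of_central_commutator (d := ⁅b, a⁆) (by simp [commutatorElement_def, mul_assoc])
    hda hdb, hk, pow_mul, hd, one_pow, one_mul]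

end ClassTwo

section PowerSeries

variable (p : ℕ) (G : Type*) [Group G]

/-- The iterated `p`-th power subgroups: each term is generated by the `p`-th powers of elements
of the previous one. -/
def iterPow : ℕ → Subgroup G
  | 0 => ⊤
  | k + 1 => Subgroup.closure ((fun g : G => g ^ p) '' (iterPow k : Set G))

variable {p G}

theorem pow_mem_iterPow {k : ℕ} {g : G} (hg : g ∈ iterPow p G k) : g ^ p ∈ iterPow p G (k + 1) :=
  Subgroup.subset_closure ⟨g, hg, rfl⟩

theorem pow_pow_mem_iterPow (g : G) (k : ℕ) : g ^ p ^ k ∈ iterPow p G k := by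
  induction k with
  | zero => exact Subgroup.mem_top _
  | succ k ih => rw [pow_succ, pow_mul]; exact pow_mem_iterPow ih

theorem iterPow_succ_le (k : ℕ) : iterPow p G (k + 1) ≤ iterPow p G k := by
  refine (Subgroup.closure_le _).2 ?_
  rintro _ ⟨g, hg, rfl⟩
  exact pow_mem hg p

theorem iterPow_antitone : Antitone (iterPow p G) := antitone_nat_of_succ_le iterPow_succ_le

instance iterPow_normal (k : ℕ) : (iterPow p G k).Normal := by
  induction k with
  | zero => exact (inferInstance : (⊤ : Subgroup G).Normal)
  | succ k ih =>
    refine ⟨fun n hn g => ?_⟩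
    have : iterPow p G (k + 1) ≤ (iterPow p G (k + 1)).comap (MulAut.conj g).toMonoidHom := by
      refine (Subgroup.closure_le _).2 ?_
      rintro _ ⟨h, hh, rfl⟩
      have := pow_mem_iterPow (ih.conj_mem h hh g)
      simpa [Subgroup.mem_comap, conj_pow] using this
    simpa using this hn

theorem exists_ne_top_forall_pow_mem [Finite G] (hp : p.Prime) (hG : IsPGroup p G)
    [Nontrivial G] : ∃ M : Subgroup G, M ≠ ⊤ ∧ ∀ g : G, g ^ p ∈ M := by
  have := Fact.mk hp
  obtain ⟨n, hn⟩ := IsPGroup.iff_card.1 hG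
  have hn0 : n ≠ 0 := by
    rintro rfl
    have := Finite.one_lt_card (α := G)
    simp [hn] at this
  obtain ⟨m, rfl⟩ := Nat.exists_eq_succ_of_ne_zero hn0
  obtain ⟨M, hM⟩ := Sylow.exists_subgroup_card_pow_prime (G := G) p (n := m)
    (hn ▸ pow_dvd_pow p (Nat.le_succ m))
  have hidx : M.index = p := by
    have h := M.card_mul_index
    rw [hM, hn, pow_succ] at h
    exact Nat.eq_of_mul_eq_mul_left (pow_pos hp.pos m) h
  have : M.Normal := Subgroup.normal_of_index_eq_minFac_card (by
    rw [hidx, hn, Nat.pow_minFac (by omega), hp.minFac_eq])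
  refine ⟨M, ?_, fun g => ?_⟩
  · rintro rfl
    rw [Subgroup.index_top] at hidx
    exact hp.one_lt.ne hidx
  · rw [← QuotientGroup.eq_one_iff, QuotientGroup.mk_pow, ← hidx]
    exact pow_card_eq_one'

theorem iterPow_succ_lt [Finite G] (hp : p.Prime) (hG : IsPGroup p G) {k : ℕ}
    (hk : iterPow p G k ≠ ⊥) : iterPow p G (k + 1) < iterPow p G k := by
  have : Nontrivial (iterPow p G k) := (Subgroup.nontrivial_iff_ne_bot _).2 hk
  obtain ⟨M, hM, hpow⟩ := exists_ne_top_forall_pow_mem hp (hG.to_subgroup (iterPow p G k))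
  refine lt_of_le_of_ne (iterPow_succ_le k) fun h => hM ?_
  have hle : iterPow p G (k + 1) ≤ M.map (iterPow p G k).subtype := by
    refine (Subgroup.closure_le _).2 ?_
    rintro _ ⟨g, hg, rfl⟩
    exact ⟨⟨g, hg⟩ ^ p, hpow _, rfl⟩
  rw [eq_top_iff]
  rintro ⟨g, hg⟩ -
  obtain ⟨m, hm, hmg⟩ := hle (h ▸ hg)
  have : m = ⟨g, hg⟩ := Subtype.ext hmg
  exact this ▸ hm

theorem exists_iterPow_eq_bot [Finite G] (hp : p.Prime) (hG : IsPGroup p G) :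
    ∃ n, iterPow p G n = ⊥ := by
  have key : ∀ k, iterPow p G k = ⊥ ∨ Nat.card (iterPow p G k) + k ≤ Nat.card G := by
    intro k
    induction k with
    | zero => exact Or.inr (Subgroup.card_le_card_group _)
    | succ k ih =>
      by_cases hk : iterPow p G k = ⊥
      · exact Or.inl (le_bot_iff.1 (hk ▸ iterPow_succ_le k))
      · right
        have h1 := ih.resolve_left hk
        have h2 : Nat.card (iterPow p G (k + 1)) < Nat.card (iterPow p G k) :=
          Set.Finite.card_lt_card (Set.toFinite _) (iterPow_succ_lt hp hG hk)
        omega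
  refine ⟨Nat.card G, (key _).resolve_right fun h => ?_⟩
  have : 0 < Nat.card (iterPow p G (Nat.card G)) := Nat.card_pos
  omega

/-- In a nilpotent group, `X ≤ Y ⊔ [X, G]` forces `X ≤ Y` for normal `Y`. -/
theorem le_of_le_sup_commutator [Group.IsNilpotent G] {X Y : Subgroup G} [Y.Normal]
    (h : X ≤ Y ⊔ ⁅X, ⊤⁆) : X ≤ Y := by
  have key : ∀ n, X ≤ Y ⊔ (⊤ : Subgroup G).lowerCentralSeries n := by
    intro n
    induction n with
    | zero => simp
    | succ n ih =>
      refine h.trans (sup_le le_sup_left ?_)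
      refine (Subgroup.commutator_mono ih le_rfl).trans (Subgroup.commutator_le.2 ?_)
      intro x hx g hg
      obtain ⟨y, hy, l, hl, rfl⟩ := Subgroup.mem_sup_of_normal_left.1 hx
      have hyl : ⁅y * l, g⁆ = y * (⁅l, g⁆ * (g * y⁻¹ * g⁻¹)) := by
        simp [commutatorElement_def, mul_assoc]
      rw [hyl]
      refine mul_mem (Subgroup.mem_sup_left hy) (mul_mem (Subgroup.mem_sup_right ?_)
        (Subgroup.mem_sup_left (‹Y.Normal›.conj_mem _ (inv_mem hy) g)))
      rw [Subgroup.lowerCentralSeries_succ]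
      exact Subgroup.commutator_mem_commutator hl hg
  obtain ⟨n, hn⟩ := Subgroup.nilpotent_iff_lowerCentralSeries.1 ‹Group.IsNilpotent G›
  simpa [hn] using key n

end PowerSeries

section Powerful

variable {p : ℕ} {G : Type*} [Group G]

theorem commutator_mem_iterPow [Finite G] (hp : p.Prime) (hodd : Odd p) (hG : IsPGroup p G)
    (hP : ∀ a b : G, ⁅a, b⁆ ∈ iterPow p G 1) (k : ℕ) :
    ∀ a ∈ iterPow p G k, ∀ g : G, ⁅a, g⁆ ∈ iterPow p G (k + 1) := by
  have := Fact.mk hp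
  have := hG.isNilpotent
  induction k with
  | zero => exact fun a _ g => hP a g
  | succ k ih =>
    suffices h : ⁅iterPow p G (k + 1), (⊤ : Subgroup G)⁆ ≤ iterPow p G (k + 2) from
      fun a ha g => h (Subgroup.commutator_mem_commutator ha (Subgroup.mem_top g))
    refine le_of_le_sup_commutator ?_
    set X := ⁅iterPow p G (k + 1), (⊤ : Subgroup G)⁆ with hX
    set R := iterPow p G (k + 2) ⊔ ⁅X, (⊤ : Subgroup G)⁆ with hR
    have hXc : ∀ d ∈ X, ∀ g : G, Commute (d : G ⧸ R) (g : G ⧸ R) := by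
      intro d hd g
      rw [← commutatorElement_eq_one_iff_commute]
      exact (QuotientGroup.eq_one_iff (N := R) ⁅d, g⁆).2
        (Subgroup.mem_sup_right (Subgroup.commutator_mem_commutator hd (Subgroup.mem_top g)))
    suffices h : iterPow p G (k + 1) ≤ (Subgroup.center (G ⧸ R)).comap (QuotientGroup.mk' R) by
      refine Subgroup.commutator_le.2 fun m hm g _ => ?_
      refine (QuotientGroup.eq_one_iff (N := R) ⁅m, g⁆).1 ?_
      exact commutatorElement_eq_one_iff_commute.2 ((Subgroup.mem_center_iff.1 (h hm) g).symm)
    refine (Subgroup.closure_le _).2 ?_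
    rintro _ ⟨n, hn, rfl⟩
    refine Subgroup.mem_center_iff.2 fun q => ?_
    obtain ⟨g, rfl⟩ := QuotientGroup.mk_surjective q
    have hc : ⁅g, n⁆ ∈ iterPow p G (k + 1) := by
      rw [← commutatorElement_inv]; exact inv_mem (ih n hn g)
    have hd : ⁅n, ⁅g, n⁆⁆ ∈ X := by
      rw [← commutatorElement_inv]
      exact inv_mem (Subgroup.commutator_mem_commutator hc (Subgroup.mem_top n))
    have hcp : ((⁅g, n⁆ : G) : G ⧸ R) ^ p = 1 :=
      (QuotientGroup.eq_one_iff (N := R) (⁅g, n⁆ ^ p)).2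
        (Subgroup.mem_sup_left (pow_mem_iterPow hc))
    have hdp : ⁅(n : G ⧸ R), ((⁅g, n⁆ : G) : G ⧸ R)⁆ ^ p = 1 := by
      have hcom : Commute ⁅(n : G ⧸ R), ((⁅g, n⁆ : G) : G ⧸ R)⁆ ((⁅g, n⁆ : G) : G ⧸ R) :=
        hXc _ hd _
      have h1 : ((n : G ⧸ R) * ((⁅g, n⁆ : G) : G ⧸ R) * (n : G ⧸ R)⁻¹) ^ p = 1 := by
        rw [conj_pow, hcp]; simp
      have h2 : (n : G ⧸ R) * ((⁅g, n⁆ : G) : G ⧸ R) * (n : G ⧸ R)⁻¹ =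
          ⁅(n : G ⧸ R), ((⁅g, n⁆ : G) : G ⧸ R)⁆ * ((⁅g, n⁆ : G) : G ⧸ R) := by
        simp [commutatorElement_def]
      rwa [h2, hcom.mul_pow, hcp, mul_one] at h1
    have h3 := mul_pow_prime_of_central_commutator hp hodd
      (a := ((⁅g, n⁆ : G) : G ⧸ R)) (b := (n : G ⧸ R)) (hXc _ hd _) (hXc _ hd _) hdp
    have h4 : ((⁅g, n⁆ : G) : G ⧸ R) * (n : G ⧸ R) = g * n * (g : G ⧸ R)⁻¹ := by
      rw [← QuotientGroup.mk_mul, ← QuotientGroup.mk_mul, ← QuotientGroup.mk_inv,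
        ← QuotientGroup.mk_mul]
      congr 1
      simp [commutatorElement_def]
    rw [h4, hcp, conj_pow, one_mul] at h3
    exact mul_inv_eq_iff_eq_mul.1 h3

/-- Modulo the term two steps further down, the `p`-th power map is multiplicative as soon as
one factor lies in the term at hand. -/
theorem mk_mul_pow_eq [Finite G] (hp : p.Prime) (hodd : Odd p) (hG : IsPGroup p G)
    (hP : ∀ a b : G, ⁅a, b⁆ ∈ iterPow p G 1) {k : ℕ} (a : G) {e : G} (he : e ∈ iterPow p G k) :
    (((a * e) ^ p : G) : G ⧸ iterPow p G (k + 2)) = ((a ^ p * e ^ p : G) : _) := by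
  have hd := commutator_mem_iterPow hp hodd hG hP k e he a
  have hcom : ∀ g : G, Commute ((⁅e, a⁆ : G) : G ⧸ iterPow p G (k + 2)) g := by
    intro g
    rw [← commutatorElement_eq_one_iff_commute]
    exact (QuotientGroup.eq_one_iff (N := iterPow p G (k + 2)) ⁅⁅e, a⁆, g⁆).2
      (commutator_mem_iterPow hp hodd hG hP (k + 1) _ hd g)
  exact mul_pow_prime_of_central_commutator hp hodd
      (a := (a : G ⧸ iterPow p G (k + 2))) (b := (e : G ⧸ iterPow p G (k + 2)))
      (hcom a) (hcom e)
      ((QuotientGroup.eq_one_iff (N := iterPow p G (k + 2)) (⁅e, a⁆ ^ p)).2 (pow_mem_iterPow hd))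

theorem exists_mk_pow_eq [Finite G] (hp : p.Prime) (hodd : Odd p) (hG : IsPGroup p G)
    (hP : ∀ a b : G, ⁅a, b⁆ ∈ iterPow p G 1) {k : ℕ} {x : G} (hx : x ∈ iterPow p G (k + 1)) :
    ∃ e ∈ iterPow p G k, ((e ^ p : G) : G ⧸ iterPow p G (k + 2)) = x := by
  induction hx using Subgroup.closure_induction with
  | mem x hx =>
    obtain ⟨e, he, rfl⟩ := hx
    exact ⟨e, he, rfl⟩
  | one => exact ⟨1, one_mem _, by simp⟩
  | mul x y _ _ hx hy =>
    obtain ⟨e, he, hex⟩ := hx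
    obtain ⟨f, hf, hfy⟩ := hy
    refine ⟨e * f, mul_mem he hf, ?_⟩
    rw [mk_mul_pow_eq hp hodd hG hP e hf, QuotientGroup.mk_mul, hex, hfy, QuotientGroup.mk_mul]
  | inv x _ hx =>
    obtain ⟨e, he, hex⟩ := hx
    refine ⟨e⁻¹, inv_mem he, ?_⟩
    rw [inv_pow, QuotientGroup.mk_inv, hex, QuotientGroup.mk_inv]

/-- In a powerful `p`-group every element of a power subgroup is itself a `p`-th power. -/
theorem exists_pow_eq_of_mem_iterPow_succ [Finite G] (hp : p.Prime) (hodd : Odd p)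
    (hG : IsPGroup p G) (hP : ∀ a b : G, ⁅a, b⁆ ∈ iterPow p G 1) {k : ℕ} {x : G}
    (hx : x ∈ iterPow p G (k + 1)) : ∃ e ∈ iterPow p G k, e ^ p = x := by
  have key : ∀ m, ∃ e ∈ iterPow p G k, (e ^ p)⁻¹ * x ∈ iterPow p G (k + m + 1) := by
    intro m
    induction m with
    | zero => exact ⟨1, one_mem _, by simpa using hx⟩
    | succ m ih =>
      obtain ⟨e, he, hex⟩ := ih
      obtain ⟨f, hf, hfx⟩ := exists_mk_pow_eq hp hodd hG hP hex
      refine ⟨e * f, mul_mem he (iterPow_antitone (Nat.le_add_right k m) hf), ?_⟩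
      rw [← QuotientGroup.eq, show k + (m + 1) + 1 = k + m + 2 by ring,
        mk_mul_pow_eq hp hodd hG hP e hf, QuotientGroup.mk_mul, hfx, ← QuotientGroup.mk_mul,
        mul_inv_cancel_left]
  obtain ⟨n, hn⟩ := exists_iterPow_eq_bot hp hG
  obtain ⟨e, he, hex⟩ := key n
  have hbot := iterPow_antitone (p := p) (G := G) (show n ≤ k + n + 1 by omega) hex
  rw [hn, Subgroup.mem_bot] at hbot
  exact ⟨e, he, inv_mul_eq_one.1 hbot⟩

theorem exists_pow_pow_eq_of_mem_iterPow [Finite G] (hp : p.Prime) (hodd : Odd p)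
    (hG : IsPGroup p G) (hP : ∀ a b : G, ⁅a, b⁆ ∈ iterPow p G 1) (k : ℕ) :
    ∀ x ∈ iterPow p G k, ∃ e : G, e ^ p ^ k = x := by
  induction k with
  | zero => exact fun x _ => ⟨x, by simp⟩
  | succ k ih =>
    intro x hx
    obtain ⟨e, he, rfl⟩ := exists_pow_eq_of_mem_iterPow_succ hp hodd hG hP hx
    obtain ⟨f, rfl⟩ := ih e he
    exact ⟨f, by rw [pow_succ, pow_mul]⟩

/-- The `p`-th powers are non-generators of a powerful `p`-group. -/
theorem zpowers_eq_top_of_sup_iterPow_one [Finite G] (hp : p.Prime) (hodd : Odd p)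
    (hG : IsPGroup p G) (hP : ∀ a b : G, ⁅a, b⁆ ∈ iterPow p G 1) {x : G}
    (hx : Subgroup.zpowers x ⊔ iterPow p G 1 = ⊤) : Subgroup.zpowers x = ⊤ := by
  have key : ∀ k, ∀ d ∈ iterPow p G k, ∃ a ∈ Subgroup.zpowers x, ∃ e ∈ iterPow p G (k + 1),
      a * e = d := by
    intro k
    induction k with
    | zero => exact fun d _ => Subgroup.mem_sup_of_normal_right.1 (hx ▸ Subgroup.mem_top d)
    | succ k ih =>
      intro d hd
      obtain ⟨f, hf, rfl⟩ := exists_pow_eq_of_mem_iterPow_succ hp hodd hG hP hd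
      obtain ⟨a, ha, e, he, rfl⟩ := ih f hf
      refine ⟨a ^ p, pow_mem ha p, (a ^ p)⁻¹ * (a * e) ^ p, ?_, mul_inv_cancel_left _ _⟩
      have h1 := iterPow_succ_le _ (QuotientGroup.eq.1 (mk_mul_pow_eq hp hodd hG hP a he).symm)
      have h2 := mul_mem (pow_mem_iterPow he) h1
      simpa [mul_assoc] using h2
  have htop : ∀ k, Subgroup.zpowers x ⊔ iterPow p G k = ⊤ := by
    intro k
    induction k with
    | zero => simp [iterPow]
    | succ k ih =>
      rw [eq_top_iff, ← ih]
      refine sup_le le_sup_left fun d hd => ?_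
      exact Subgroup.mem_sup_of_normal_right.2 (key k d hd)
  obtain ⟨n, hn⟩ := exists_iterPow_eq_bot hp hG
  simpa [hn] using htop n

end Powerful

section QuasiPowerful

/-- Every commutator is a `p`-th power up to a central factor. For finite `p`-groups with `p` odd
this is equivalent to being quasi-powerful. -/
def CommutatorsArePowers (p : ℕ) (G : Type*) [Group G] : Prop :=
  ∀ a b : G, ∃ g : G, ∃ z ∈ Subgroup.center G, ⁅a, b⁆ = g ^ p * z

/-- The preimage in `G` of the subgroup of `G / Z(G)` generated by `x` and the `p`-th powers. -/
def powExtension (p : ℕ) {G : Type*} [Group G] (x : G) : Subgroup G :=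
  (Subgroup.zpowers (x : G ⧸ Subgroup.center G) ⊔ iterPow p (G ⧸ Subgroup.center G) 1).comap
    (QuotientGroup.mk' (Subgroup.center G))

variable {p : ℕ} {G : Type*} [Group G]

theorem IsQuasiPowerful.commutatorsArePowers [Finite G] (hp : p.Prime) (hodd : Odd p)
    (hG : IsPGroup p G) (h : IsQuasiPowerful p G) : CommutatorsArePowers p G := by
  intro a b
  have hpow : powSubgroup (G ⧸ Subgroup.center G) p ≤ iterPow p (G ⧸ Subgroup.center G) 1 := by
    refine (Subgroup.closure_le _).2 ?_
    rintro _ ⟨g, rfl⟩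
    exact pow_mem_iterPow (Subgroup.mem_top g)
  have hP : ∀ a b : G ⧸ Subgroup.center G, ⁅a, b⁆ ∈ iterPow p (G ⧸ Subgroup.center G) 1 :=
    fun a b => hpow (h (Subgroup.commutator_mem_commutator (Subgroup.mem_top a)
      (Subgroup.mem_top b)))
  obtain ⟨q, -, hq⟩ := exists_pow_eq_of_mem_iterPow_succ hp hodd (hG.to_quotient _) hP (hP a b)
  obtain ⟨g, rfl⟩ := QuotientGroup.mk_surjective q
  exact ⟨g, (g ^ p)⁻¹ * ⁅a, b⁆, QuotientGroup.eq.1 hq, (mul_inv_cancel_left _ _).symm⟩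

namespace CommutatorsArePowers

theorem commutator_mem_iterPow_one (h : CommutatorsArePowers p G) (a b : G ⧸ Subgroup.center G) :
    ⁅a, b⁆ ∈ iterPow p (G ⧸ Subgroup.center G) 1 := by
  obtain ⟨a, rfl⟩ := QuotientGroup.mk_surjective a
  obtain ⟨b, rfl⟩ := QuotientGroup.mk_surjective b
  obtain ⟨g, z, hz, hab⟩ := h a b
  have : ⁅(a : G ⧸ Subgroup.center G), (b : G ⧸ Subgroup.center G)⁆ = (g : _) ^ p := by
    change ((⁅a, b⁆ : G) : G ⧸ Subgroup.center G) = _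
    rw [hab, QuotientGroup.mk_mul, (QuotientGroup.eq_one_iff z).2 hz, mul_one,
      QuotientGroup.mk_pow]
  rw [this]
  exact pow_mem_iterPow (Subgroup.mem_top _)

theorem quotient (h : CommutatorsArePowers p G) (N : Subgroup G) [N.Normal] :
    CommutatorsArePowers p (G ⧸ N) := by
  intro a b
  obtain ⟨a, rfl⟩ := QuotientGroup.mk_surjective a
  obtain ⟨b, rfl⟩ := QuotientGroup.mk_surjective b
  obtain ⟨g, z, hz, hab⟩ := h a b
  refine ⟨g, z, Subgroup.mem_center_iff.2 fun q => ?_, ?_⟩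
  · obtain ⟨q, rfl⟩ := QuotientGroup.mk_surjective q
    exact congrArg (QuotientGroup.mk (s := N)) (Subgroup.mem_center_iff.1 hz q)
  · exact congrArg (QuotientGroup.mk (s := N)) hab

theorem commutator_mem_powExtension (h : CommutatorsArePowers p G) (x a b : G) :
    ⁅a, b⁆ ∈ powExtension p x :=
  Subgroup.mem_sup_right (h.commutator_mem_iterPow_one a b)

end CommutatorsArePowers

theorem self_mem_powExtension (x : G) : x ∈ powExtension p x :=
  Subgroup.mem_sup_left (Subgroup.mem_zpowers _)

theorem mem_center_subgroup {H : Subgroup G} {x : H} (hx : (x : G) ∈ Subgroup.center G) :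
    x ∈ Subgroup.center H :=
  Subgroup.mem_center_iff.2 fun g => Subtype.ext (Subgroup.mem_center_iff.1 hx g)

theorem commutatorsArePowers_powExtension [Finite G] (h : CommutatorsArePowers p G) (hp : p.Prime)
    (hodd : Odd p) (hG : IsPGroup p G) (x : G) : CommutatorsArePowers p (powExtension p x) := by
  have hGQ := hG.to_quotient (Subgroup.center G)
  have hP := h.commutator_mem_iterPow_one
  rintro ⟨a, ha⟩ ⟨b, hb⟩
  have hab : ((⁅a, b⁆ : G) : G ⧸ Subgroup.center G) ∈ iterPow p (G ⧸ Subgroup.center G) 2 := by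
    set D := iterPow p (G ⧸ Subgroup.center G) 2
    have hcom : ∀ d ∈ iterPow p (G ⧸ Subgroup.center G) 1, ∀ g : G ⧸ Subgroup.center G,
        Commute (d : (G ⧸ Subgroup.center G) ⧸ D) g := by
      intro d hd g
      rw [← commutatorElement_eq_one_iff_commute]
      exact (QuotientGroup.eq_one_iff (N := D) ⁅d, g⁆).2
        (commutator_mem_iterPow hp hodd hGQ hP 1 d hd g)
    obtain ⟨_, ⟨m, rfl⟩, d, hd, had⟩ := Subgroup.mem_sup_of_normal_right.1 ha
    obtain ⟨_, ⟨n, rfl⟩, e, he, hbe⟩ := Subgroup.mem_sup_of_normal_right.1 hb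
    simp only [QuotientGroup.mk'_apply] at had hbe
    have h1 : ((⁅a, b⁆ : G) : G ⧸ Subgroup.center G) =
        ⁅(x : G ⧸ Subgroup.center G) ^ m * d, (x : G ⧸ Subgroup.center G) ^ n * e⁆ := by
      rw [had, hbe]; rfl
    rw [h1]
    have hxx : Commute (((x : G ⧸ Subgroup.center G) ^ m : G ⧸ Subgroup.center G) : _ ⧸ D)
        (((x : G ⧸ Subgroup.center G) ^ n : G ⧸ Subgroup.center G) : _ ⧸ D) :=
      ((Commute.refl (x : G ⧸ Subgroup.center G)).zpow_zpow m n).map (QuotientGroup.mk' D)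
    refine (QuotientGroup.eq_one_iff (N := D) _).1 (commutatorElement_eq_one_iff_commute.2 ?_ :
      ⁅(((x : G ⧸ Subgroup.center G) ^ m : G ⧸ Subgroup.center G) : _ ⧸ D) * d,
        (((x : G ⧸ Subgroup.center G) ^ n : G ⧸ Subgroup.center G) : _ ⧸ D) * e⁆ = 1)
    exact (hxx.mul_right (hcom e he _).symm).mul_left (hcom d hd ((x : _) ^ n * e))
  obtain ⟨q, hq, hqab⟩ := exists_pow_eq_of_mem_iterPow_succ hp hodd hGQ hP hab
  obtain ⟨g, rfl⟩ := QuotientGroup.mk_surjective q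
  have hz : (g ^ p)⁻¹ * ⁅a, b⁆ ∈ Subgroup.center G := QuotientGroup.eq.1 hqab
  have hg : g ∈ powExtension p x := Subgroup.mem_sup_right hq
  refine ⟨⟨g, hg⟩, ((⟨g, hg⟩ : powExtension p x) ^ p)⁻¹ * ⁅(⟨a, ha⟩ : powExtension p x), ⟨b, hb⟩⁆,
    mem_center_subgroup hz,
    (mul_inv_cancel_left _ _).symm⟩

theorem commute_of_powExtension_eq_top [Finite G] (h : CommutatorsArePowers p G) (hp : p.Prime)
    (hodd : Odd p) (hG : IsPGroup p G) {x : G} (hx : powExtension p x = ⊤) (a b : G) :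
    Commute a b := by
  have h1 : Subgroup.zpowers (x : G ⧸ Subgroup.center G) ⊔
      iterPow p (G ⧸ Subgroup.center G) 1 = ⊤ :=
    Subgroup.comap_injective (QuotientGroup.mk'_surjective _) (hx.trans (Subgroup.comap_top _).symm)
  have h2 := zpowers_eq_top_of_sup_iterPow_one hp hodd (hG.to_quotient _)
    h.commutator_mem_iterPow_one h1
  have : IsCyclic (G ⧸ Subgroup.center G) :=
    ⟨(x : G ⧸ Subgroup.center G), fun y => h2.ge (Subgroup.mem_top y)⟩
  have := MonoidHom.isMulCommutative_of_isCyclic_of_ker_le_center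
    (QuotientGroup.mk' (Subgroup.center G)) (QuotientGroup.ker_mk' _).le
  exact mul_comm' a b

/-- The `p`-th power map is multiplicative on elements whose `p`-th powers are central. -/
def PowMulOfCentral (p : ℕ) (G : Type*) [Group G] : Prop :=
  ∀ x y : G, x ^ p ∈ Subgroup.center G → y ^ p ∈ Subgroup.center G →
    (x * y) ^ p = x ^ p * y ^ p

/-- If `x` and `y` have orders dividing `p ^ (i + 1)` and `p ^ i` modulo the centre, then
`x ^ p ^ i` commutes with `y`. -/
def PowCommute (p : ℕ) (G : Type*) [Group G] (i : ℕ) : Prop :=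
  ∀ x y : G, x ^ p ^ (i + 1) ∈ Subgroup.center G → y ^ p ^ i ∈ Subgroup.center G →
    Commute (x ^ p ^ i) y

/-- The subgroup formed by the elements of `H` whose `p`-th power is trivial. -/
def omegaOne (H : Subgroup G) (h : PowMulOfCentral p H) : Subgroup G where
  carrier := {g | g ∈ H ∧ g ^ p = 1}
  one_mem' := ⟨one_mem _, one_pow _⟩
  inv_mem' := fun {g} hg => ⟨inv_mem hg.1, by rw [inv_pow, hg.2, inv_one]⟩
  mul_mem' := by
    rintro a b ⟨ha, hap⟩ ⟨hb, hbp⟩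
    refine ⟨mul_mem ha hb, ?_⟩
    have h1 : (⟨a, ha⟩ : H) ^ p = 1 := Subtype.ext hap
    have h2 : (⟨b, hb⟩ : H) ^ p = 1 := Subtype.ext hbp
    have h3 := h ⟨a, ha⟩ ⟨b, hb⟩ (h1 ▸ one_mem _) (h2 ▸ one_mem _)
    rw [h1, h2, mul_one] at h3
    exact congrArg Subtype.val h3

theorem omegaOne_normal (H : Subgroup G) (h : PowMulOfCentral p H) [H.Normal] :
    (omegaOne H h).Normal :=
  ⟨fun n hn g => ⟨‹H.Normal›.conj_mem n hn.1 g, by rw [conj_pow, hn.2]; simp⟩⟩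

theorem powExtension_normal_of (h : CommutatorsArePowers p G) (x : G) :
    (powExtension p x).Normal := by
  refine ⟨fun n hn g => ?_⟩
  have : g * n * g⁻¹ = ⁅g, n⁆ * n := by simp [commutatorElement_def]
  rw [this]
  exact mul_mem (h.commutator_mem_powExtension x g n) hn

theorem commutator_pow_eq_one_of_central (h : CommutatorsArePowers p G) {y : G}
    (hmul : PowMulOfCentral p (powExtension p y)) (hy : y ^ p ∈ Subgroup.center G) (x : G) :
    ⁅x, y⁆ ^ p = 1 := by
  have hn := powExtension_normal_of h y
  have hy' : y ∈ powExtension p y := self_mem_powExtension y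
  have hconj : (x * y * x⁻¹) ^ p = y ^ p := by
    rw [conj_pow, Subgroup.mem_center_iff.1 hy x, mul_inv_cancel_right]
  have h1 := hmul ⟨x * y * x⁻¹, hn.conj_mem y hy' x⟩ ⟨y⁻¹, inv_mem hy'⟩
    (mem_center_subgroup (by simpa [hconj] using hy))
    (mem_center_subgroup (by simpa using hy))
  have h2 := congrArg Subtype.val h1
  simp only [Subgroup.coe_mul, Subgroup.coe_pow] at h2
  rw [hconj, inv_pow, mul_inv_cancel] at h2
  exact h2

end QuasiPowerful

section Induction

variable {p : ℕ} {G : Type*} [Group G]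

theorem pow_mul_mem_center {c r z : G} {m n : ℕ} (hz : z ∈ Subgroup.center G)
    (hc : c = r ^ m * z) (hcn : c ^ n = 1) : r ^ (m * n) ∈ Subgroup.center G := by
  have hcom : Commute (r ^ m) z := Subgroup.mem_center_iff.1 hz _
  rw [hc, hcom.mul_pow, ← pow_mul] at hcn
  rw [eq_inv_of_mul_eq_one_left hcn]
  exact inv_mem (pow_mem hz n)

theorem commute_of_eq_mul_central {c r z g : G} (hz : z ∈ Subgroup.center G) (hc : c = r * z)
    (h : Commute r g) : Commute c g :=
  hc ▸ h.mul_left (Subgroup.mem_center_iff.1 hz g).symm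

theorem commutator_pow_eq_one_symm {x y : G} {n : ℕ} (h : ⁅x, y⁆ ^ n = 1) : ⁅y, x⁆ ^ n = 1 := by
  rw [← commutatorElement_inv, inv_pow, h, inv_one]

theorem mem_iterPow_commutator [Finite G] (h : CommutatorsArePowers p G) (hp : p.Prime)
    (hodd : Odd p) (hG : IsPGroup p G) {k : ℕ} {a : G}
    (ha : (a : G ⧸ Subgroup.center G) ∈ iterPow p (G ⧸ Subgroup.center G) k) (g : G) :
    ((⁅g, a⁆ : G) : G ⧸ Subgroup.center G) ∈ iterPow p (G ⧸ Subgroup.center G) (k + 1) := by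
  rw [← commutatorElement_inv]
  exact inv_mem (commutator_mem_iterPow hp hodd (hG.to_quotient _) h.commutator_mem_iterPow_one
    k _ ha g)

theorem commute_pow_of_commutator_pow_eq_one [Finite G] (h : CommutatorsArePowers p G)
    (hp : p.Prime) (hodd : Odd p) (hG : IsPGroup p G)
    (hcomm : ∀ x y : G, y ^ p ∈ Subgroup.center G → ⁅x, y⁆ ^ p = 1) {i : ℕ} {w y : G}
    (hext : PowCommute p (powExtension p w) 1) (hnext : PowCommute p G (i + 2))
    (hw : w ^ p ^ 2 ∈ Subgroup.center G) (hv : ⁅y, w⁆ ^ p = 1)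
    (hvi : ((⁅y, w⁆ : G) : G ⧸ Subgroup.center G) ∈ iterPow p (G ⧸ Subgroup.center G) (i + 1)) :
    Commute (w ^ p) y := by
  set v := ⁅y, w⁆ with hvdef
  have hcp : ⁅w, v⁆ ^ p = 1 := hcomm w v (hv ▸ one_mem _)
  have hcw : Commute ⁅w, v⁆ w := by
    obtain ⟨q, hq⟩ := exists_pow_pow_eq_of_mem_iterPow hp hodd (hG.to_quotient _)
      h.commutator_mem_iterPow_one (i + 2) _ (mem_iterPow_commutator h hp hodd hG hvi w)
    obtain ⟨r, rfl⟩ := QuotientGroup.mk_surjective q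
    have hz : (r ^ p ^ (i + 2))⁻¹ * ⁅w, v⁆ ∈ Subgroup.center G := QuotientGroup.eq.1 hq
    have hc : ⁅w, v⁆ = r ^ p ^ (i + 2) * ((r ^ p ^ (i + 2))⁻¹ * ⁅w, v⁆) :=
      (mul_inv_cancel_left _ _).symm
    refine commute_of_eq_mul_central hz hc (hnext r w ?_ ?_)
    · rw [pow_succ]
      exact pow_mul_mem_center hz hc hcp
    · rw [add_comm, pow_add, pow_mul]
      exact pow_mem hw _
  have hcv : Commute ⁅w, v⁆ v := by
    have hwT : w ∈ powExtension p w := self_mem_powExtension w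
    have hvT : v ∈ powExtension p w := h.commutator_mem_powExtension w y w
    obtain ⟨t, z, hz, hc⟩ := commutatorsArePowers_powExtension h hp hodd hG w ⟨w, hwT⟩ ⟨v, hvT⟩
    have h1 : t ^ p ^ 2 ∈ Subgroup.center (powExtension p w) := by
      rw [pow_two]
      exact pow_mul_mem_center hz hc (Subtype.ext hcp)
    have h2 : (⟨v, hvT⟩ : powExtension p w) ^ p ^ 1 ∈ Subgroup.center (powExtension p w) := by
      rw [pow_one]
      exact mem_center_subgroup (by simp [hv])
    have h3 := hext t ⟨v, hvT⟩ h1 h2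
    rw [pow_one] at h3
    exact (commute_of_eq_mul_central hz hc h3).map (powExtension p w).subtype
  have h4 := mul_pow_prime_of_central_commutator hp hodd hcv hcw hcp
  have h5 : v * w = y * w * y⁻¹ := by simp [hvdef, commutatorElement_def]
  rw [h5, conj_pow, hv, one_mul] at h4
  exact (mul_inv_eq_iff_eq_mul.1 h4).symm

theorem powMulOfCentral_of_powCommute (h : CommutatorsArePowers p G) (hp : p.Prime)
    (hodd : Odd p) (hcomm : ∀ x y : G, y ^ p ∈ Subgroup.center G → ⁅x, y⁆ ^ p = 1)
    (hS : PowCommute p G 1) : PowMulOfCentral p G := by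
  intro x y hx hy
  have hcp : ⁅y, x⁆ ^ p = 1 := hcomm y x hx
  obtain ⟨g, z, hz, hc⟩ := h y x
  have hg : g ^ p ^ (1 + 1) ∈ Subgroup.center G := by
    rw [one_add_one_eq_two, pow_two]
    exact pow_mul_mem_center hz hc hcp
  have hS' : ∀ y : G, y ^ p ∈ Subgroup.center G → Commute (g ^ p) y := by
    intro y hy
    simpa using hS g y hg (by simpa using hy)
  exact mul_pow_prime_of_central_commutator hp hodd (commute_of_eq_mul_central hz hc (hS' x hx))
    (commute_of_eq_mul_central hz hc (hS' y hy)) hcp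

theorem commutator_pow_mem_omegaOne (h : CommutatorsArePowers p G)
    (hcomm : ∀ x y : G, y ^ p ∈ Subgroup.center G → ⁅x, y⁆ ^ p = 1) {w : G}
    (hmul : PowMulOfCentral p (powExtension p w)) {x : G} {i : ℕ}
    (hx : x ^ p ^ (i + 1) ∈ Subgroup.center G) (g : G) :
    ⁅g, x ^ p ^ i⁆ ∈ omegaOne (powExtension p w) hmul :=
  ⟨h.commutator_mem_powExtension _ _ _, hcomm _ _ (by rwa [← pow_mul, ← pow_succ])⟩

theorem card_quotient_lt [Finite G] {N : Subgroup G} (hN : N ≠ ⊥) :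
    Nat.card (G ⧸ N) < Nat.card G := by
  rw [N.card_eq_card_quotient_mul_card_subgroup]
  exact lt_mul_of_one_lt_right Nat.card_pos (N.one_lt_card_iff_ne_bot.2 hN)

theorem card_subgroup_lt [Finite G] {N : Subgroup G} (hN : N ≠ ⊤) : Nat.card N < Nat.card G :=
  lt_of_not_ge fun h => hN (N.eq_top_of_le_card h)

theorem powMulOfCentral_and_powCommute (hp : p.Prime) (hodd : Odd p) (n : ℕ) :
    ∀ (G : Type*) [Group G] [Finite G], Nat.card G = n → IsPGroup p G →
      CommutatorsArePowers p G → PowMulOfCentral p G ∧ ∀ i, PowCommute p G (i + 1) := by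
  induction n using Nat.strong_induction_on with
  | _ n ih =>
    intro G _ _ hn hG h
    by_cases hab : ∀ a b : G, Commute a b
    · exact ⟨fun x y _ _ => (hab x y).mul_pow p, fun i x y _ _ => hab _ _⟩
    have hsub : ∀ w : G, PowMulOfCentral p (powExtension p w) ∧
        ∀ i, PowCommute p (powExtension p w) (i + 1) := fun w =>
      ih _ (hn ▸ card_subgroup_lt fun htop =>
          hab (commute_of_powExtension_eq_top h hp hodd hG htop))
        _ rfl (hG.to_subgroup _) (commutatorsArePowers_powExtension h hp hodd hG w)
    have hcomm : ∀ x y : G, y ^ p ∈ Subgroup.center G → ⁅x, y⁆ ^ p = 1 := fun x y hy =>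
      commutator_pow_eq_one_of_central h (hsub y).1 hy x
    have hstep : ∀ i, PowCommute p G (i + 2) → PowCommute p G (i + 1) := by
      intro i hnext x y hx hy
      have hw : (x ^ p ^ i) ^ p ^ 2 ∈ Subgroup.center G := by
        rwa [← pow_mul, ← pow_add]
      have hvi : ((⁅y, x ^ p ^ i⁆ : G) : G ⧸ Subgroup.center G) ∈
          iterPow p (G ⧸ Subgroup.center G) (i + 1) :=
        mem_iterPow_commutator h hp hodd hG 
          (pow_pow_mem_iterPow (x : G ⧸ Subgroup.center G) i) y
      rw [pow_succ, pow_mul]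
      suffices hv : ⁅y, x ^ p ^ i⁆ ^ p = 1 from
        commute_pow_of_commutator_pow_eq_one h hp hodd hG hcomm ((hsub _).2 0) hnext hw hv hvi
      cases i with
      | zero => exact commutator_pow_eq_one_symm (hcomm _ _ (by simpa using hy))
      | succ i =>
        have := powExtension_normal_of h (1 : G)
        set E := omegaOne (powExtension p (1 : G)) (hsub 1).1
        have hEn : E.Normal := omegaOne_normal _ _
        have hcen : ∀ (a : G) (j : ℕ), a ^ p ^ (j + 1) ∈ Subgroup.center G →
            ((a ^ p ^ j : G) : G ⧸ E) ∈ Subgroup.center (G ⧸ E) := by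
          intro a j ha
          refine Subgroup.mem_center_iff.2 fun q => ?_
          obtain ⟨g, rfl⟩ := QuotientGroup.mk_surjective q
          exact commutatorElement_eq_one_iff_commute.1 ((QuotientGroup.eq_one_iff (N := E) _).2
            (commutator_pow_mem_omegaOne h hcomm (hsub 1).1 ha g))
        have hmem : ⁅y, x ^ p ^ (i + 1)⁆ ∈ E := by
          by_cases hbot : E = ⊥
          · have hx' : x ^ p ^ (i + 1 + 1) ∈ Subgroup.center G := by
              refine Subgroup.mem_center_iff.2 fun g => ?_
              have hg : ⁅g, x ^ p ^ (i + 1 + 1)⁆ ∈ E :=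
                commutator_pow_mem_omegaOne h hcomm (hsub 1).1 hx g
              rw [hbot, Subgroup.mem_bot] at hg
              exact commutatorElement_eq_one_iff_commute.1 hg
            exact commutator_pow_mem_omegaOne h hcomm (hsub 1).1 hx' y
          · have hquot := (ih _ (hn ▸ card_quotient_lt hbot) _ rfl (hG.to_quotient E)
              (h.quotient E)).2 i (x : G ⧸ E) (y : G ⧸ E) (hcen x _ hx) (hcen y _ hy)
            exact (QuotientGroup.eq_one_iff (N := E) _).1
              (commutatorElement_eq_one_iff_commute.2 hquot.symm)
        exact hmem.2
    obtain ⟨N, hN⟩ : ∃ N, ∀ x : G, x ^ p ^ N = 1 := by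
      have := Fact.mk hp
      obtain ⟨N, hN⟩ := IsPGroup.iff_card.1 hG
      exact ⟨N, fun x => hN ▸ pow_card_eq_one'⟩
    have hS : ∀ m i, N ≤ i + m → PowCommute p G (i + 1) := by
      intro m
      induction m with
      | zero =>
        intro i hi x y _ _
        obtain ⟨j, rfl⟩ := Nat.exists_eq_add_of_le hi
        rw [add_assoc, pow_add, pow_mul, hN, one_pow]
        exact Commute.one_left y
      | succ m ihm => exact fun i hi => hstep i (ihm (i + 1) (by omega))
    have hS' : ∀ i, PowCommute p G (i + 1) := fun i => hS N i (Nat.le_add_left _ _)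
    exact ⟨powMulOfCentral_of_powCommute h hp hodd hcomm (hS' 0), hS'⟩

theorem commutator_pow_eq_one (hp : p.Prime) (hodd : Odd p) (i : ℕ) :
    ∀ (G : Type*) [Group G] [Finite G], IsPGroup p G → CommutatorsArePowers p G →
      ∀ x y : G, y ^ p ^ i = 1 → ⁅x, y⁆ ^ p ^ i = 1 := by
  induction i with
  | zero =>
    intro G _ _ _ _ x y hy
    rw [pow_zero, pow_one] at hy
    simp [hy]
  | succ i ih =>
    intro G _ _ hG h x y hy
    have hmul : PowMulOfCentral p (⊤ : Subgroup G) := by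
      have hcen : ∀ z ∈ Subgroup.center (⊤ : Subgroup G), (z : G) ∈ Subgroup.center G :=
        fun z hz => Subgroup.mem_center_iff.2 fun g =>
          congrArg Subtype.val (Subgroup.mem_center_iff.1 hz ⟨g, Subgroup.mem_top g⟩)
      exact fun a b ha hb => Subtype.ext
        ((powMulOfCentral_and_powCommute hp hodd _ G rfl hG h).1 a b (hcen _ ha) (hcen _ hb))
    have hE : (omegaOne ⊤ hmul).Normal := omegaOne_normal _ _
    have hq := ih (G ⧸ omegaOne ⊤ hmul) (hG.to_quotient _) (h.quotient _) x y
      ((QuotientGroup.eq_one_iff (N := omegaOne ⊤ hmul) (y ^ p ^ i)).2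
        ⟨Subgroup.mem_top _, by rwa [← pow_mul, ← pow_succ]⟩)
    have hmem := (QuotientGroup.eq_one_iff (N := omegaOne ⊤ hmul) (⁅x, y⁆ ^ p ^ i)).1 hq
    rw [pow_succ, pow_mul]
    exact hmem.2

end Induction

theorem orderOf_commutator_dvd (p : ℕ) (hp : p.Prime) (hodd : Odd p)
    (G : Type*) [Group G] [Finite G]
    (hG : IsPGroup p G) (hQP : IsQuasiPowerful p G) (x y : G) :
    orderOf (pcomm x y) ∣ orderOf y := by
  have := Fact.mk hp
  obtain ⟨k, hk⟩ := IsPGroup.iff_orderOf.1 hG y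
  have hy : y⁻¹ ^ p ^ k = 1 := by rw [← hk, inv_pow, pow_orderOf_eq_one, inv_one]
  have hxy : pcomm x y = ⁅x⁻¹, y⁻¹⁆ := by simp [pcomm, commutatorElement_def]
  rw [hxy, hk]
  exact orderOf_dvd_of_pow_eq_one
    (commutator_pow_eq_one hp hodd k G hG (hQP.commutatorsArePowers hp hodd hG) x⁻¹ y⁻¹ hy)
end
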